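/- Let M ∈ ℝ^{m×m} be symmetric positive definite, G ∈ ℝ^{n×m} an arbitrary matrix (not necessarily of full row rank), K, B ∈ ℝ^{n×n} nonnegative diagonal matrices, and h > 0. Then the matrix I + G M⁻¹ Gᵀ (h²K + hB) ∈ ℝ^{n×n} is invertible. Hence the bilateral constraint solver's update matrix is well defined even when the constraints are redundant, and the resulting constraint forces are uniquely determined. -/

import Mathlib

open Matrix

open scoped MatrixOrder Matrix.Norms.L2Operator in
/-- If `S` and `D` are positive semidefinite, then `1 + S * D` is invertible. -/
theorem Matrix.PosSemidef.isUnit_one_add_mul {ι : Type*} [Fintype ι] [DecidableEq ι]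
    {S D : Matrix ι ι ℝ} (hS : S.PosSemidef) (hD : D.PosSemidef) : IsUnit (1 + S * D) := by
  obtain ⟨C, rfl⟩ := CStarAlgebra.nonneg_iff_eq_star_mul_self.mp hD.nonneg
  have hpos : (1 + C * (S * Cᴴ)).PosDef := by
    rw [← Matrix.mul_assoc]
    exact Matrix.PosDef.one.add_posSemidef (hS.mul_mul_conjTranspose_same C)
  rw [Matrix.star_eq_conjTranspose, Matrix.isUnit_iff_isUnit_det, ← Matrix.mul_assoc,
    Matrix.det_one_add_mul_comm]
  exact hpos.det_pos.ne'.isUnit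

/-- A diagonal matrix with nonnegative diagonal entries is positive semidefinite. -/
theorem Matrix.IsDiag.posSemidef {ι : Type*} [DecidableEq ι]
    {D : Matrix ι ι ℝ} (hD : D.IsDiag) (hnn : ∀ i, 0 ≤ D i i) : D.PosSemidef := by
  rw [← hD.diagonal_diag]
  exact Matrix.PosSemidef.diagonal hnn

/-- The bilateral constraint solver's update matrix `I + G M⁻¹ Gᵀ (h²K + hB)` is
invertible even when the constraints are redundant (G need not have full row rank). -/
theorem stmt12 {m n : ℕ} (M : Matrix (Fin m) (Fin m) ℝ) (G : Matrix (Fin n) (Fin m) ℝ)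
    (K B : Matrix (Fin n) (Fin n) ℝ) (h : ℝ) (hh : 0 < h)
    (hM : M.PosDef)
    (hK : K.IsDiag) (hKnn : ∀ i, 0 ≤ K i i)
    (hB : B.IsDiag) (hBnn : ∀ i, 0 ≤ B i i) :
    IsUnit (1 + G * M⁻¹ * Gᵀ * (h ^ 2 • K + h • B)) := by
  have hS : (G * M⁻¹ * Gᵀ).PosSemidef := by
    simpa using hM.inv.posSemidef.mul_mul_conjTranspose_same G
  exact hS.isUnit_one_add_mul
    (((hK.posSemidef hKnn).smul (sq_nonneg h)).add ((hB.posSemidef hBnn).smul hh.le))
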